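/- Let λ, c₁, h, ρ₀, ρ₁ > 0 and let u, v be coefficient families with |u| ≤ ρ₀, ‖u‖ ≤ ρ₁ and |u − v|² ≤ c₁ h² ‖u‖². Then the smoothed interpolant satisfies the a priori bounds |P_λ v| ≤ ρ_J and ‖P_λ v‖ ≤ ρ_K, where ρ_J = (λ^{−1} + c₁ h²)^{1/2} ρ₁ + ρ₀ and ρ_K = (1 + λ c₁ h²)^{1/2} ρ₁ + ρ₁. -/

import Mathlib

open scoped ENNReal Real

noncomputable section

/-- The index set `𝒥 = {2πn/L : n ∈ ℤ² \ {0}}`, parametrized by `n ∈ ℤ² \ {0}`. -/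
abbrev Idx : Type := {n : ℤ × ℤ // n ≠ 0}

/-- The Euclidean length `|k|` of the wave vector `k = 2πn/L`. -/
noncomputable def knorm (L : ℝ) (k : Idx) : ℝ :=
  (2 * Real.pi / L) * Real.sqrt ((k.1.1 : ℝ) ^ 2 + (k.1.2 : ℝ) ^ 2)

/-- A coefficient family `u : 𝒥 → ℂ²`, `k ↦ u_k`. -/
abbrev CoeffFamily : Type := Idx → EuclideanSpace ℂ (Fin 2)

/-- `‖u‖_α² = L² ∑_{k ∈ 𝒥} |k|^{2α} |u_k|²`, with values in `[0,∞]`. -/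
noncomputable def VnormSq (L α : ℝ) (u : CoeffFamily) : ℝ≥0∞ :=
  ENNReal.ofReal (L ^ 2) *
    ∑' k : Idx, ENNReal.ofReal (knorm L k ^ (2 * α) * ‖u k‖ ^ 2)

/-- `‖u‖_α = (‖u‖_α²)^{1/2}`, with values in `[0,∞]`. -/
noncomputable def Vnorm (L α : ℝ) (u : CoeffFamily) : ℝ≥0∞ :=
  VnormSq L α u ^ ((1 : ℝ) / 2)

/-- The spectral filter `P_λ`: keep the modes with `|k|² ≤ λ`, discard the rest. -/
noncomputable def Pfilter (L lam : ℝ) (u : CoeffFamily) : CoeffFamily :=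
  fun k => if knorm L k ^ 2 ≤ lam then u k else 0

theorem knorm_nonneg {L : ℝ} (hL : 0 < L) (k : Idx) : 0 ≤ knorm L k := by
  unfold knorm
  positivity

/-- Minkowski's inequality for `ℓ²` sums in `[0,∞]`. -/
theorem ENNReal.tsum_sq_add_rpow_half_le {ι : Type*} (f g : ι → ℝ≥0∞) :
    (∑' i, (f i + g i) ^ (2 : ℝ)) ^ ((1 : ℝ) / 2)
      ≤ (∑' i, f i ^ (2 : ℝ)) ^ ((1 : ℝ) / 2) + (∑' i, g i ^ (2 : ℝ)) ^ ((1 : ℝ) / 2) := by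
  let _ : MeasurableSpace ι := ⊤
  have key := ENNReal.lintegral_Lp_add_le (μ := MeasureTheory.Measure.count) (p := 2)
    (f := f) (g := g) measurable_from_top.aemeasurable measurable_from_top.aemeasurable
    (by norm_num)
  simpa only [MeasureTheory.lintegral_count, Pi.add_apply] using key

theorem VnormSq_eq_tsum_rpow {L : ℝ} (hL : 0 < L) (α : ℝ) (u : CoeffFamily) :
    VnormSq L α u = ∑' k, ENNReal.ofReal (L * knorm L k ^ α * ‖u k‖) ^ (2 : ℝ) := by
  rw [VnormSq, ← ENNReal.tsum_mul_left]
  refine tsum_congr fun k => ?_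
  have hk := knorm_nonneg hL k
  rw [← ENNReal.ofReal_mul (by positivity),
    ENNReal.ofReal_rpow_of_nonneg (by positivity) (by norm_num), mul_comm 2 α,
    Real.rpow_mul hk]
  norm_num only [Real.rpow_two]
  congr 1
  ring

theorem Vnorm_add_le {L : ℝ} (hL : 0 < L) (α : ℝ) (u v : CoeffFamily) :
    Vnorm L α (u + v) ≤ Vnorm L α u + Vnorm L α v := by
  simp only [Vnorm, VnormSq_eq_tsum_rpow hL]
  refine le_trans ?_ (ENNReal.tsum_sq_add_rpow_half_le _ _)
  gcongr with k
  have hk := knorm_nonneg hL k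
  rw [← ENNReal.ofReal_add (by positivity) (by positivity), ← mul_add]
  gcongr
  exact norm_add_le _ _

theorem VnormSq_le_mul {L : ℝ} {C : ℝ} (hC : 0 ≤ C) {α β : ℝ} {u v : CoeffFamily}
    (huv : ∀ k, knorm L k ^ (2 * α) * ‖u k‖ ^ 2 ≤ C * (knorm L k ^ (2 * β) * ‖v k‖ ^ 2)) :
    VnormSq L α u ≤ ENNReal.ofReal C * VnormSq L β v := by
  rw [VnormSq, VnormSq, mul_left_comm, ← ENNReal.tsum_mul_left (a := ENNReal.ofReal C)]
  gcongr with k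
  rw [← ENNReal.ofReal_mul hC]
  exact ENNReal.ofReal_le_ofReal (huv k)

theorem norm_Pfilter_le (L lam : ℝ) (u : CoeffFamily) (k : Idx) :
    ‖Pfilter L lam u k‖ ≤ ‖u k‖ := by
  unfold Pfilter
  split_ifs <;> simp

theorem Vnorm_Pfilter_le {L : ℝ} (hL : 0 < L) (lam α : ℝ) (u : CoeffFamily) :
    Vnorm L α (Pfilter L lam u) ≤ Vnorm L α u := by
  refine ENNReal.rpow_le_rpow ?_ (by norm_num)
  have := VnormSq_le_mul (L := L) (α := α) (β := α) (u := Pfilter L lam u) (v := u)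
    zero_le_one fun k => by
      have := norm_Pfilter_le L lam u k
      have hk := knorm_nonneg hL k
      rw [one_mul]
      gcongr
  simpa using this

/-- The inverse inequality `‖P_λ u‖² ≤ λ |u|²`. -/
theorem VnormSq_one_Pfilter_le (L : ℝ) {lam : ℝ} (hlam : 0 ≤ lam) (u : CoeffFamily) :
    VnormSq L 1 (Pfilter L lam u) ≤ ENNReal.ofReal lam * VnormSq L 0 u := by
  refine VnormSq_le_mul hlam fun k => ?_
  unfold Pfilter
  split_ifs with hk
  · norm_num only [mul_one, mul_zero, Real.rpow_zero, Real.rpow_two, one_mul]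
    gcongr
  · simp only [norm_zero]
    norm_num
    positivity

theorem Pfilter_add (L lam : ℝ) (u v : CoeffFamily) :
    Pfilter L lam (u + v) = Pfilter L lam u + Pfilter L lam v := by
  funext k
  by_cases hk : knorm L k ^ 2 ≤ lam <;> simp [Pfilter, hk]

theorem Vnorm_neg (L α : ℝ) (u : CoeffFamily) : Vnorm L α (-u) = Vnorm L α u := by
  simp [Vnorm, VnormSq]

theorem Vnorm_Pfilter_le_sub_add {L : ℝ} (hL : 0 < L) (lam α : ℝ) (u v : CoeffFamily) :
    Vnorm L α (Pfilter L lam v) ≤ Vnorm L α (Pfilter L lam (u - v)) + Vnorm L α u := by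
  have hneg : Pfilter L lam (-(u - v)) = -Pfilter L lam (u - v) := by
    funext k
    by_cases hk : knorm L k ^ 2 ≤ lam <;> simp [Pfilter, hk]
  calc Vnorm L α (Pfilter L lam v)
      = Vnorm L α (Pfilter L lam (-(u - v)) + Pfilter L lam u) := by
        rw [← Pfilter_add]; congr 2; abel
    _ ≤ Vnorm L α (Pfilter L lam (-(u - v))) + Vnorm L α (Pfilter L lam u) :=
        Vnorm_add_le hL α _ _
    _ ≤ Vnorm L α (Pfilter L lam (u - v)) + Vnorm L α u := by
        rw [hneg, Vnorm_neg]
        gcongr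
        exact Vnorm_Pfilter_le hL lam α u

theorem Vnorm_le_sqrt_mul {L C ρ α β : ℝ} (hC : 0 ≤ C) {w u : CoeffFamily}
    (hw : VnormSq L α w ≤ ENNReal.ofReal C * VnormSq L β u)
    (hu : Vnorm L β u ≤ ENNReal.ofReal ρ) :
    Vnorm L α w ≤ ENNReal.ofReal (√C * ρ) := by
  calc Vnorm L α w ≤ (ENNReal.ofReal C * VnormSq L β u) ^ ((1 : ℝ) / 2) :=
        ENNReal.rpow_le_rpow hw (by norm_num)
    _ = ENNReal.ofReal (√C) * Vnorm L β u := by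
        rw [ENNReal.mul_rpow_of_nonneg _ _ (by norm_num),
          ENNReal.ofReal_rpow_of_nonneg hC (by norm_num), ← Real.sqrt_eq_rpow, Vnorm]
    _ ≤ ENNReal.ofReal (√C) * ENNReal.ofReal ρ := by gcongr
    _ = ENNReal.ofReal (√C * ρ) := (ENNReal.ofReal_mul (Real.sqrt_nonneg C)).symm

/-- a priori bounds on the smoothed interpolant:
if `|u| ≤ ρ₀` and `‖u‖ ≤ ρ₁` then `|P_λ v| ≤ ρ_J` and `‖P_λ v‖ ≤ ρ_K`, where
`ρ_J = (λ⁻¹ + c₁h²)^{1/2} ρ₁ + ρ₀` and `ρ_K = (1 + λc₁h²)^{1/2} ρ₁ + ρ₁`. -/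
theorem smoothed_interpolant_apriori (L : ℝ) (hL : 0 < L) (lam c₁ h ρ₀ ρ₁ : ℝ)
    (hlam : 0 < lam) (hc₁ : 0 < c₁) (hh : 0 < h) (hρ₀ : 0 < ρ₀) (hρ₁ : 0 < ρ₁)
    (u v : CoeffFamily)
    (hu0 : Vnorm L 0 u ≤ ENNReal.ofReal ρ₀)
    (hu1 : Vnorm L 1 u ≤ ENNReal.ofReal ρ₁)
    (hv : VnormSq L 0 (fun k => u k - v k)
        ≤ ENNReal.ofReal (c₁ * h ^ 2) * VnormSq L 1 u) :
    Vnorm L 0 (Pfilter L lam v)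
        ≤ ENNReal.ofReal (Real.sqrt (lam⁻¹ + c₁ * h ^ 2) * ρ₁ + ρ₀)
    ∧ Vnorm L 1 (Pfilter L lam v)
        ≤ ENNReal.ofReal (Real.sqrt (1 + lam * c₁ * h ^ 2) * ρ₁ + ρ₁) := by
  have hbound : ∀ {α C D ρ : ℝ}, 0 ≤ C → C ≤ D → 0 < ρ →
      VnormSq L α (Pfilter L lam (u - v)) ≤ ENNReal.ofReal C * VnormSq L 1 u →
      Vnorm L α u ≤ ENNReal.ofReal ρ →
      Vnorm L α (Pfilter L lam v) ≤ ENNReal.ofReal (√D * ρ₁ + ρ) := by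
    intro α C D ρ hC hCD hρ hw hu
    refine (Vnorm_Pfilter_le_sub_add hL lam α u v).trans ?_
    rw [ENNReal.ofReal_add (by positivity) hρ.le]
    refine add_le_add ((Vnorm_le_sqrt_mul hC hw hu1).trans ?_) hu
    gcongr
  constructor
  · refine hbound (C := c₁ * h ^ 2) (by positivity) ?_ hρ₀ (le_trans ?_ hv) hu0
    · have := inv_pos.mpr hlam
      linarith
    · exact (ENNReal.rpow_le_rpow_iff (by norm_num : (0 : ℝ) < 1 / 2)).mp
        (Vnorm_Pfilter_le hL lam 0 (u - v))
  · refine hbound (C := lam * (c₁ * h ^ 2)) (by positivity) (by linarith) hρ₁ ?_ hu1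
    refine (VnormSq_one_Pfilter_le L hlam.le (u - v)).trans ?_
    rw [ENNReal.ofReal_mul hlam.le, mul_assoc]
    gcongr
    exact hv
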